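/- (L^1 decorrelation) Fix integers M, \kappa, \lambda \geq 1 with 2\pi\sqrt{3}\lambda/\kappa \leq 1/3 and \lambda^4 (2\pi\sqrt{3}\lambda/\kappa)^M \leq 1. Let f be a \mathbb{T}^3-periodic function with \|D^j f\|_{L^1(\mathbb{T}^3)} \leq C_f \lambda^j for all 0 \leq j \leq M+4, and let g be (\mathbb{T}/\kappa)^3-periodic. Then \|fg\|_{L^1(\mathbb{T}^3)} \leq C\, C_f \|g\|_{L^1(\mathbb{T}^3)} for a universal constant C. -/

import Mathlib

open MeasureTheory Real

lemma aux_point {E : Type*} [NormedAddCommGroup E] [NormedSpace ℝ E] [CompleteSpace E]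
    (u u' : ℝ → E) (v : ℝ → ℝ) (hu : ∀ t, HasDerivAt u (u' t) t) (hu' : Continuous u')
    (hv : Continuous v) (huv : ∀ t, ‖u' t‖ ≤ v t) (h a : ℝ) (hh : 0 < h) :
    ‖u a‖ ≤ ∫ t in a..(a + h), (h⁻¹ * ‖u t‖ + v t) := by
  have hc : Continuous u := continuous_iff_continuousAt.2 fun t => (hu t).continuousAt
  have hah : a ≤ a + h := by linarith
  set K := ∫ t in a..(a + h), v t with hK
  have key : ∀ y ∈ Set.Icc a (a + h), ‖u a‖ ≤ ‖u y‖ + K := by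
    intro y hy
    have h1 : ∫ t in a..y, u' t = u y - u a :=
      intervalIntegral.integral_eq_sub_of_hasDerivAt (fun t _ => hu t)
        (hu'.intervalIntegrable _ _)
    have h2 : ‖∫ t in a..y, u' t‖ ≤ ∫ t in a..y, v t :=
      intervalIntegral.norm_integral_le_of_norm_le hy.1
        (Filter.Eventually.of_forall fun t _ => huv t) (hv.intervalIntegrable _ _)
    have h3 : ∫ t in a..y, v t ≤ K := by
      apply intervalIntegral.integral_mono_interval le_rfl hy.1 hy.2
      · exact Filter.Eventually.of_forall fun t => (norm_nonneg _).trans (huv t)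
      · exact hv.intervalIntegrable _ _
    have h4 : ‖u a‖ ≤ ‖u y‖ + ‖u y - u a‖ := by
      have := norm_sub_le (u y) (u y - u a)
      simpa using this
    rw [h1] at h2
    linarith
  have h5 : ∫ t in a..(a + h), ‖u a‖ ≤ ∫ t in a..(a + h), (‖u t‖ + K) :=
    intervalIntegral.integral_mono_on hah (by simp)
      ((hc.norm.add continuous_const).intervalIntegrable _ _) key
  rw [intervalIntegral.integral_add (hc.norm.intervalIntegrable _ _) (by simp)] at h5
  rw [intervalIntegral.integral_add ((hc.norm.const_mul _).intervalIntegrable _ _)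
    (hv.intervalIntegrable _ _), intervalIntegral.integral_const_mul]
  simp only [intervalIntegral.integral_const, add_sub_cancel_left, smul_eq_mul] at h5
  rw [← hK]
  have : ‖u a‖ = h⁻¹ * (h * ‖u a‖) := by field_simp
  rw [this]
  have h6 : h⁻¹ * (h * ‖u a‖) ≤ h⁻¹ * ((∫ t in a..(a + h), ‖u t‖) + h * K) := by gcongr
  have h7 : h⁻¹ * (h * K) = K := by field_simp
  rw [mul_add, h7] at h6
  exact h6

lemma aux_sum {E : Type*} [NormedAddCommGroup E] [NormedSpace ℝ E] [CompleteSpace E]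
    (u u' : ℝ → E) (v : ℝ → ℝ) (hu : ∀ t, HasDerivAt u (u' t) t) (hu' : Continuous u')
    (hv : Continuous v) (huv : ∀ t, ‖u' t‖ ≤ v t) (κ : ℕ) (h P : ℝ) (hh : 0 < h)
    (hP : κ * h = P)
    (hup : ∀ t, u (t + P) = u t) (hvp : ∀ t, v (t + P) = v t) (x : ℝ) :
    ∑ k : Fin κ, ‖u (x + h * (k : ℕ))‖ ≤ ∫ t in 0..P, (h⁻¹ * ‖u t‖ + v t) := by
  have hc : Continuous u := continuous_iff_continuousAt.2 fun t => (hu t).continuousAt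
  have hw : Continuous fun t => h⁻¹ * ‖u t‖ + v t := by fun_prop
  have hper : Function.Periodic (fun t => h⁻¹ * ‖u t‖ + v t) P := by
    intro t; simp [hup, hvp]
  have h1 := hper.intervalIntegral_add_eq 0 x
  rw [zero_add] at h1
  have h2 := intervalIntegral.sum_integral_adjacent_intervals
    (f := fun t => h⁻¹ * ‖u t‖ + v t) (μ := volume) (a := fun k : ℕ => x + h * k) (n := κ)
    (fun k _ => hw.intervalIntegrable _ _)
  have h3 : x + h * (κ : ℝ) = x + P := by rw [← hP]; ring
  rw [h1, ← h3]
  simp only [Nat.cast_zero, mul_zero, add_zero] at h2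
  rw [← h2, Finset.sum_range]
  apply Finset.sum_le_sum
  intro k _
  have := aux_point u u' v hu hu' hv huv h (x + h * (k : ℕ)) hh
  have he : x + h * ((k + 1 : ℕ) : ℝ) = x + h * (k : ℕ) + h := by push_cast; ring
  rw [he]
  exact this

lemma aux_fubini (n : ℕ) (P : ℝ) (hP : 0 ≤ P) (G : (Fin (n + 1) → ℝ) → ℝ) (hG : Continuous G) :
    ∫ x in Set.Icc (0 : Fin (n + 1) → ℝ) (fun _ => P), G x =
      ∫ t in 0..P, ∫ y in Set.Icc (0 : Fin n → ℝ) (fun _ => P), G (Fin.cons t y) := by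
  have e := (volume_preserving_piFinSuccAbove (fun _ : Fin (n + 1) => ℝ) 0).symm
  have h1 := e.setIntegral_preimage_emb (MeasurableEquiv.measurableEmbedding _) G
    (Set.Icc (0 : Fin (n + 1) → ℝ) (fun _ => P))
  rw [← h1]
  have h2 : (MeasurableEquiv.piFinSuccAbove (fun _ : Fin (n + 1) => ℝ) 0).symm ⁻¹'
      Set.Icc (0 : Fin (n + 1) → ℝ) (fun _ => P) =
      Set.Icc (0 : ℝ) P ×ˢ Set.Icc (0 : Fin n → ℝ) (fun _ => P) := by
    ext p
    simp [Pi.le_def, Prod.le_def, Fin.forall_fin_succ, MeasurableEquiv.piFinSuccAbove,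
      Fin.insertNthEquiv]
  rw [h2, Measure.volume_eq_prod, setIntegral_prod]
  · rw [intervalIntegral.integral_of_le hP, ← integral_Icc_eq_integral_Ioc]
    simp [MeasurableEquiv.piFinSuccAbove, Fin.insertNthEquiv]
  · apply ContinuousOn.integrableOn_compact
    · exact isCompact_Icc.prod isCompact_Icc
    · apply Continuous.continuousOn
      apply hG.comp
      simp only [MeasurableEquiv.piFinSuccAbove, Fin.insertNthEquiv]
      simp
      fun_prop

lemma aux_translate (n : ℕ) (P : ℝ) (hP : 0 < P) (φ : (Fin n → ℝ) → ℝ)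
    (hφ : ∀ x j, φ (x + Pi.single j P) = φ x) (v : Fin n → ℝ) :
    ∫ x in Set.Icc (0 : Fin n → ℝ) (fun _ => P), φ (x + v) =
      ∫ x in Set.Icc (0 : Fin n → ℝ) (fun _ => P), φ x := by
  let b := (Pi.basisFun ℝ (Fin n)).unitsSMul (fun _ => Units.mk0 P hP.ne')
  have hb : ∀ j, b j = Pi.single j P := by
    intro j
    simp [b, Module.Basis.unitsSMul_apply, Units.smul_def, ← Pi.single_smul]
  have hd : ZSpan.fundamentalDomain b = Set.pi Set.univ (fun _ => Set.Ico 0 P) := by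
    ext x
    simp only [ZSpan.mem_fundamentalDomain, b, Module.Basis.repr_unitsSMul]
    simp [Units.smul_def]
    refine forall_congr' fun i => ?_
    rw [inv_mul_lt_iff₀ hP, mul_one]
    constructor
    · rintro ⟨h1, h2⟩; exact ⟨by by_contra hx; push Not at hx; nlinarith [mul_neg_of_pos_of_neg (inv_pos.2 hP) hx], h2⟩
    · rintro ⟨h1, h2⟩; exact ⟨by positivity, h2⟩
  have hae : (ZSpan.fundamentalDomain b) =ᵐ[volume] Set.Icc (0 : Fin n → ℝ) (fun _ => P) := by
    rw [hd]
    exact Measure.univ_pi_Ico_ae_eq_Icc (μ := fun _ => (volume : Measure ℝ)) (f := (0 : Fin n → ℝ)) (g := fun _ => P)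
  rw [← setIntegral_congr_set hae, ← setIntegral_congr_set hae]
  have hF := ZSpan.isAddFundamentalDomain b (volume : Measure (Fin n → ℝ))
  have hF2 := hF.vadd_of_comm v
  have hinv : ∀ (w : Submodule.span ℤ (Set.range b)) (x), φ (w +ᵥ x) = φ x := by
    rintro ⟨w, hw⟩ x
    change φ (w + x) = φ x
    revert x
    induction hw using Submodule.span_induction with
    | mem w hw =>
      obtain ⟨j, rfl⟩ := hw
      intro x; rw [hb, add_comm, hφ]
    | zero => simp
    | add w1 w2 _ _ h1 h2 => intro x; rw [add_assoc, h1, h2]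
    | smul a w _ h =>
      have hp : Function.Periodic φ w := fun x => by rw [add_comm]; exact h x
      intro x
      rw [add_comm]; exact hp.zsmul a x
  have : VAddInvariantMeasure (Submodule.span ℤ (Set.range b)) (Fin n → ℝ) volume :=
    ⟨fun c s _ => measure_preimage_add volume (c : Fin n → ℝ) s⟩
  have : MeasurableConstVAdd (Submodule.span ℤ (Set.range b)) (Fin n → ℝ) :=
    ⟨fun c => measurable_const_add (c : Fin n → ℝ)⟩
  rw [hF.setIntegral_eq hF2 hinv]
  have := (measurePreserving_vadd v (volume : Measure (Fin n → ℝ))).setIntegral_image_emb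
    (measurableEmbedding_const_vadd v) φ (ZSpan.fundamentalDomain b)
  rw [Set.image_vadd] at this
  rw [this]
  simp [add_comm]

/-- One step of the iteration. -/
noncomputable def stepT {X : Type*} (h : ℝ) (N : ℕ → X → ℝ) : ℕ → X → ℝ :=
  fun j x => h⁻¹ * N j x + N (j + 1) x

lemma aux_main (κ : ℕ) (h P : ℝ) (hh0 : 0 < h) (hP : 0 ≤ P) (n : ℕ) :
    ∀ (N : ℕ → (Fin n → ℝ) → ℝ) (_ : ∀ j ≤ n, Continuous (N j))
      (_ : ∀ j < n, ∀ (x : Fin n → ℝ) (i : Fin n),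
        ∑ k : Fin κ, N j (Function.update x i (x i + h * (k : ℕ))) ≤
          ∫ t in 0..P, stepT h N j (Function.update x i t)) (x : Fin n → ℝ),
    ∑ k : Fin n → Fin κ, N 0 (fun i => x i + h * (k i : ℕ)) ≤
      ∫ y in Set.Icc (0 : Fin n → ℝ) (fun _ => P), ((stepT h)^[n] N) 0 y := by
  induction n with
  | zero =>
    intro N _ _ x
    have : Set.Icc (0 : Fin 0 → ℝ) (fun _ => P) = Set.univ := by
      ext y; simp [Subsingleton.elim y 0]
    rw [this]
    simp [integral_unique, measureReal_def, volume_pi]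
    exact le_of_eq (congrArg _ (Subsingleton.elim _ _))
  | succ n ih =>
    intro N hN H x
    have hT : ∀ j ≤ n, Continuous (stepT h N j) := by
      intro j hj
      have h1 := hN j (by omega)
      have h2 := hN (j + 1) (by omega)
      unfold stepT
      fun_prop
    have hTc : ∀ j ≤ n, ∀ t : ℝ, Continuous fun y : Fin n → ℝ => stepT h N j (Fin.cons t y) := by
      intro j hj t
      exact (hT j hj).comp (by fun_prop)
    have hTt : ∀ j ≤ n, ∀ y : Fin n → ℝ, Continuous fun t : ℝ => stepT h N j (Fin.cons t y) := by
      intro j hj t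
      exact (hT j hj).comp (by fun_prop)
    have hiter : ∀ (m : ℕ) (N' : ℕ → (Fin (n + 1) → ℝ) → ℝ) (t : ℝ) (j : ℕ) (y : Fin n → ℝ),
        ((stepT h)^[m] N') j (Fin.cons t y) =
          ((stepT h)^[m] (fun j y => N' j (Fin.cons t y))) j y := by
      intro m
      induction m with
      | zero => intros; rfl
      | succ m ihm =>
        intro N' t j y
        rw [Function.iterate_succ_apply, Function.iterate_succ_apply, ihm]
        rfl
    have hitc : ∀ (m : ℕ) (N' : ℕ → (Fin (n + 1) → ℝ) → ℝ) (J : ℕ)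
        (_ : ∀ j ≤ J + m, Continuous (N' j)), ∀ j ≤ J, Continuous ((stepT h)^[m] N' j) := by
      intro m
      induction m with
      | zero => intro N' J hc j hj; exact hc j (by omega)
      | succ m ihm =>
        intro N' J hc
        rw [Function.iterate_succ_apply]
        apply ihm
        intro j hj
        have h1 := hc j (by omega)
        have h2 := hc (j + 1) (by omega)
        unfold stepT
        fun_prop
    have hfin : Continuous ((stepT h)^[n + 1] N 0) :=
      hitc (n + 1) N 0 (fun j hj => hN j (by omega)) 0 le_rfl
    rw [aux_fubini n P hP _ hfin]
    rw [← (Fin.consEquiv (fun _ : Fin (n + 1) => Fin κ)).sum_comp, Fintype.sum_prod_type_right]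
    have hpt : ∀ (a : Fin κ) (k : Fin n → Fin κ),
        (fun i => x i + h * (((Fin.consEquiv (fun _ : Fin (n + 1) => Fin κ)) (a, k) i : Fin κ) : ℕ))
          = (Fin.cons (x 0 + h * (a : ℕ)) (fun i => x i.succ + h * (k i : ℕ)) :
              Fin (n + 1) → ℝ) := by
      intro a k
      ext i
      refine Fin.cases ?_ (fun i => ?_) i <;> simp [Fin.consEquiv]
    simp only [hpt]
    have hstep : ∀ k : Fin n → Fin κ,
        ∑ a : Fin κ, N 0 (Fin.cons (x 0 + h * (a : ℕ)) (fun i => x i.succ + h * (k i : ℕ))) ≤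
        ∫ t in 0..P, stepT h N 0 (Fin.cons t (fun i => x i.succ + h * (k i : ℕ))) := by
      intro k
      have := H 0 (by omega) (Fin.cons (x 0) (fun i => x i.succ + h * (k i : ℕ))) 0
      simpa [Fin.update_cons_zero] using this
    refine (Finset.sum_le_sum fun k _ => hstep k).trans ?_
    rw [← intervalIntegral.integral_finsetSum
      (fun k _ => (hTt 0 (by omega) _).intervalIntegrable _ _)]
    apply intervalIntegral.integral_mono_on hP
    · apply Continuous.intervalIntegrable
      exact continuous_finsetSum _ fun k _ => hTt 0 (by omega) _
    · apply Continuous.intervalIntegrable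
      apply continuous_parametric_integral_of_continuous _ isCompact_Icc
      apply hfin.comp
      fun_prop
    · intro t _
      simp only [Function.iterate_succ_apply, hiter]
      apply ih (fun j y => stepT h N j (Fin.cons t y)) (fun j hj => hTc j hj t)
      intro j hj y i
      have hup : ∀ s : ℝ, (Fin.cons t (Function.update y i s) : Fin (n + 1) → ℝ) =
          Function.update (Fin.cons t y) i.succ s := fun s => by rw [Fin.cons_update]
      have hupc : Continuous fun s : ℝ => Function.update (Fin.cons t y : Fin (n + 1) → ℝ) i.succ s :=
        continuous_const.update _ continuous_id
      have e1 := H j (by omega) (Fin.cons t y) i.succ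
      have e2 := H (j + 1) (by omega) (Fin.cons t y) i.succ
      simp only [Fin.cons_succ] at e1 e2
      simp only [hup]
      have i1 : IntervalIntegrable
          (fun s => stepT h N j (Function.update (Fin.cons t y) i.succ s)) volume 0 P :=
        ((hT j (by omega)).comp hupc).intervalIntegrable _ _
      have i2 : IntervalIntegrable
          (fun s => stepT h N (j + 1) (Function.update (Fin.cons t y) i.succ s)) volume 0 P :=
        ((hT (j + 1) (by omega)).comp hupc).intervalIntegrable _ _
      change ∑ k : Fin κ, (h⁻¹ * N j _ + N (j + 1) _) ≤
        ∫ s in 0..P, (h⁻¹ * stepT h N j (Fin.cons t (Function.update y i s)) +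
          stepT h N (j + 1) (Fin.cons t (Function.update y i s)))
      simp only [hup]
      rw [Finset.sum_add_distrib, ← Finset.mul_sum, intervalIntegral.integral_add
        (i1.const_mul _) i2, intervalIntegral.integral_const_mul]
      have hh : 0 ≤ h⁻¹ := (inv_pos.2 hh0).le
      gcongr

lemma aux_periodic_deriv {n : ℕ} (P : ℝ) (f : (Fin n → ℝ) → ℝ)
    (hf : ∀ x j, f (x + Pi.single j P) = f x) (m : ℕ) (x : Fin n → ℝ) (j : Fin n) :
    iteratedFDeriv ℝ m f (x + Pi.single j P) = iteratedFDeriv ℝ m f x := by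
  rw [← iteratedFDeriv_comp_add_right]
  congr 1
  funext z
  exact hf z j

lemma aux_step {n : ℕ} (κ : ℕ) (h P : ℝ) (hh : 0 < h) (hP : κ * h = P) (m : ℕ)
    (f : (Fin n → ℝ) → ℝ) (hc : ContDiff ℝ m f)
    (hf : ∀ x j, f (x + Pi.single j P) = f x) (j : ℕ) (hj : j < m) (x : Fin n → ℝ) (i : Fin n) :
    ∑ k : Fin κ, ‖iteratedFDeriv ℝ j f (Function.update x i (x i + h * (k : ℕ)))‖ ≤
      ∫ t in 0..P, stepT h (fun j x => ‖iteratedFDeriv ℝ j f x‖) j (Function.update x i t) := by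
  have hup : ∀ t : ℝ, Function.update x i (t + P) = Function.update x i t + Pi.single i P := by
    intro t
    ext l
    by_cases hl : l = i
    · subst hl; simp
    · simp [hl]
  have hupc : Continuous fun s : ℝ => Function.update x i s :=
    continuous_const.update _ continuous_id
  have hd : Differentiable ℝ (iteratedFDeriv ℝ j f) :=
    hc.differentiable_iteratedFDeriv (by exact_mod_cast hj)
  have hfd : Continuous (fderiv ℝ (iteratedFDeriv ℝ j f)) := by
    rw [fderiv_iteratedFDeriv]
    exact (LinearIsometryEquiv.continuous _).comp
      (hc.continuous_iteratedFDeriv (m := j + 1) (by exact_mod_cast hj))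
  refine aux_sum (fun t => iteratedFDeriv ℝ j f (Function.update x i t))
    (fun t => fderiv ℝ (iteratedFDeriv ℝ j f) (Function.update x i t) (Pi.single i 1))
    (fun t => ‖iteratedFDeriv ℝ (j + 1) f (Function.update x i t)‖) ?_ ?_ ?_ ?_ κ h P hh hP ?_ ?_
    (x i)
  · intro t
    exact (hd _).hasFDerivAt.comp_hasDerivAt t (hasDerivAt_update x i t)
  · exact (hfd.comp hupc).clm_apply continuous_const
  · exact ((hc.continuous_iteratedFDeriv (m := j + 1) (by exact_mod_cast hj)).comp hupc).norm
  · intro t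
    rw [← norm_fderiv_iteratedFDeriv]
    refine (ContinuousLinearMap.le_opNorm _ _).trans ?_
    rw [Pi.norm_single]
    simp
  · intro t
    simp only [hup, aux_periodic_deriv P f hf]
  · intro t
    simp only [hup, aux_periodic_deriv P f hf]



/-- (`L¹` decorrelation) There is a universal constant `C` with the following property. Fix
integers `M, κ, λ ≥ 1` with `2π√3 λ/κ ≤ 1/3` and `λ⁴ (2π√3 λ/κ)^M ≤ 1`. Let `f` be a
`𝕋³`-periodic function with `‖D^j f‖_{L¹(𝕋³)} ≤ C_f λ^j` for all `0 ≤ j ≤ M+4`, and let `g` be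
`(𝕋/κ)³`-periodic and integrable. Then `‖fg‖_{L¹(𝕋³)} ≤ C C_f ‖g‖_{L¹(𝕋³)}`. -/
theorem L1_decorrelation :
    ∃ C : ℝ, 0 < C ∧
      ∀ (M κ lam : ℕ), 1 ≤ M → 1 ≤ κ → 1 ≤ lam →
        2 * Real.pi * Real.sqrt 3 * lam / κ ≤ 1 / 3 →
        (lam : ℝ) ^ 4 * (2 * Real.pi * Real.sqrt 3 * lam / κ) ^ M ≤ 1 →
        ∀ (f g : (Fin 3 → ℝ) → ℝ) (C_f : ℝ),
          ContDiff ℝ (M + 4) f →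
          (∀ (x : Fin 3 → ℝ) (j : Fin 3), f (x + Pi.single j (2 * Real.pi)) = f x) →
          (∀ j : ℕ, j ≤ M + 4 →
            (∫ x in Set.Icc (0 : Fin 3 → ℝ) (fun _ => 2 * Real.pi),
                ‖iteratedFDeriv ℝ j f x‖) ≤ C_f * (lam : ℝ) ^ j) →
          (∀ (x : Fin 3 → ℝ) (j : Fin 3), g (x + Pi.single j (2 * Real.pi / κ)) = g x) →
          IntegrableOn g (Set.Icc (0 : Fin 3 → ℝ) (fun _ => 2 * Real.pi)) →
          (∫ x in Set.Icc (0 : Fin 3 → ℝ) (fun _ => 2 * Real.pi), |f x * g x|) ≤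
            C * C_f * ∫ x in Set.Icc (0 : Fin 3 → ℝ) (fun _ => 2 * Real.pi), |g x| := by
  refine ⟨1, one_pos, ?_⟩
  intro M κ lam hM hκ hlam hsmall _ f g C_f hfc hfp hfD hgp hgi
  set P : ℝ := 2 * Real.pi with hPdef
  set Q : Set (Fin 3 → ℝ) := Set.Icc (0 : Fin 3 → ℝ) (fun _ => P) with hQ
  have hP2 : 2 ≤ P := by have := Real.two_le_pi; rw [hPdef]; linarith
  have hP : 0 < P := by linarith
  have hκ0 : (0 : ℝ) < κ := by exact_mod_cast hκ
  set h : ℝ := P / κ with hh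
  have hh0 : 0 < h := by positivity
  have hκh : κ * h = P := by rw [hh]; field_simp
  have hlam0 : (0 : ℝ) ≤ lam := Nat.cast_nonneg _
  have hr : h * lam ≤ 1 := by
    have h3 : (1 : ℝ) ≤ Real.sqrt 3 := Real.one_le_sqrt.2 (by norm_num)
    have e : P * Real.sqrt 3 * lam / κ = h * lam * Real.sqrt 3 := by rw [hh]; ring
    rw [e] at hsmall
    have : 0 ≤ h * lam := by positivity
    nlinarith
  have hr0 : 0 ≤ h * lam := by positivity
  set N : ℕ → (Fin 3 → ℝ) → ℝ := fun j x => ‖iteratedFDeriv ℝ j f x‖ with hN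
  have hc : ContDiff ℝ (3 : ℕ) f := hfc.of_le (by
    have : (3 : ℕ) ≤ M + 4 := by omega
    exact_mod_cast this)
  have hNc : ∀ j ≤ 3, Continuous (N j) := fun j hj =>
    (hc.continuous_iteratedFDeriv (by exact_mod_cast hj)).norm
  have hNi : ∀ j ≤ 3, IntegrableOn (N j) Q := fun j hj =>
    (hNc j hj).continuousOn.integrableOn_compact isCompact_Icc
  have hNb : ∀ j ≤ 3, ∫ x in Q, N j x ≤ C_f * (lam : ℝ) ^ j := fun j hj => hfD j (by omega)
  have hCf : 0 ≤ C_f := by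
    have h1 := hNb 0 (by omega)
    have h2 : 0 ≤ ∫ x in Q, N 0 x := integral_nonneg fun x => norm_nonneg _
    simp only [pow_zero, mul_one] at h1
    linarith
  -- the discrete sums are bounded
  have hF : ∀ x : Fin 3 → ℝ,
      ∑ k : Fin 3 → Fin κ, |f (fun i => x i + h * (k i : ℕ))| ≤ (κ : ℝ) ^ 3 * C_f := by
    intro x
    have h1 := aux_main κ h P hh0 hP.le 3 N hNc
      (fun j hj x i => aux_step κ h P hh0 hκh 3 f hc hfp j hj x i) x
    have h2 : ∫ y in Q, ((stepT h)^[3] N) 0 y =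
        h⁻¹ ^ 3 * (∫ y in Q, N 0 y) + 3 * h⁻¹ ^ 2 * (∫ y in Q, N 1 y) +
          3 * h⁻¹ * (∫ y in Q, N 2 y) + ∫ y in Q, N 3 y := by
      have i0 := (hNi 0 (by omega)).const_mul (h⁻¹ ^ 3)
      have i1 := (hNi 1 (by omega)).const_mul (3 * h⁻¹ ^ 2)
      have i2 := (hNi 2 (by omega)).const_mul (3 * h⁻¹)
      have i3 := hNi 3 (by omega)
      have i01 : Integrable (fun y => h⁻¹ ^ 3 * N 0 y + 3 * h⁻¹ ^ 2 * N 1 y)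
        (volume.restrict Q) := i0.add i1
      have i012 : Integrable (fun y => h⁻¹ ^ 3 * N 0 y + 3 * h⁻¹ ^ 2 * N 1 y + 3 * h⁻¹ * N 2 y)
        (volume.restrict Q) := i01.add i2
      rw [← integral_const_mul, ← integral_const_mul, ← integral_const_mul,
        ← integral_add i0 i1, ← integral_add i01 i2,
        ← integral_add i012 i3]
      congr 1
      funext y
      simp only [Function.iterate_succ_apply, Function.iterate_zero_apply, stepT]
      ring
    have h3 : ∑ k : Fin 3 → Fin κ, |f (fun i => x i + h * (k i : ℕ))| =
        ∑ k : Fin 3 → Fin κ, N 0 (fun i => x i + h * (k i : ℕ)) := by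
      simp [hN, norm_iteratedFDeriv_zero]
    rw [h3]
    refine h1.trans ?_
    change ∫ y in Q, ((stepT h)^[3] N) 0 y ≤ _
    rw [h2]
    have hi : 0 < h⁻¹ := inv_pos.2 hh0
    have b0 := hNb 0 (by omega)
    have b1 := hNb 1 (by omega)
    have b2 := hNb 2 (by omega)
    have b3 := hNb 3 (by omega)
    calc _ ≤ h⁻¹ ^ 3 * (C_f * (lam : ℝ) ^ 0) + 3 * h⁻¹ ^ 2 * (C_f * (lam : ℝ) ^ 1) +
          3 * h⁻¹ * (C_f * (lam : ℝ) ^ 2) + C_f * (lam : ℝ) ^ 3 := by gcongr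
      _ = h⁻¹ ^ 3 * C_f * (1 + h * lam) ^ 3 := by field_simp; ring
      _ ≤ h⁻¹ ^ 3 * C_f * (1 + 1) ^ 3 := by gcongr
      _ = (κ : ℝ) ^ 3 * C_f * (2 / P) ^ 3 := by rw [hh]; field_simp; norm_num
      _ ≤ (κ : ℝ) ^ 3 * C_f * 1 ^ 3 := by
          gcongr
          rw [div_le_one hP]; exact hP2
      _ = _ := by ring
  -- periodicity of `g`
  have hgk : ∀ (j : Fin 3) (m : ℕ) (x : Fin 3 → ℝ), g (x + Pi.single j (h * m)) = g x := by
    intro j m x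
    have hp : Function.Periodic g (Pi.single j h) := fun x => hgp x j
    have := hp.nsmul m x
    rwa [← Pi.single_smul, nsmul_eq_mul, mul_comm] at this
  have hgP : ∀ (x : Fin 3 → ℝ) (j : Fin 3), g (x + Pi.single j P) = g x := by
    intro x j
    rw [← hκh, mul_comm]; exact hgk j κ x
  have hgv : ∀ (k : Fin 3 → Fin κ) (x : Fin 3 → ℝ),
      g (x + fun i => h * (k i : ℕ)) = g x := by
    intro k x
    have e : (x + fun i => h * ((k i : ℕ) : ℝ)) = x + Pi.single 0 (h * ((k 0 : ℕ) : ℝ)) +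
        Pi.single 1 (h * ((k 1 : ℕ) : ℝ)) + Pi.single 2 (h * ((k 2 : ℕ) : ℝ)) := by
      ext i
      fin_cases i <;> simp
    rw [e, hgk, hgk, hgk]
  have htr : ∀ k : Fin 3 → Fin κ,
      ∫ x in Q, |f (fun i => x i + h * (k i : ℕ))| * |g x| = ∫ x in Q, |f x * g x| := by
    intro k
    rw [← aux_translate 3 P hP (fun x => |f x * g x|) (fun x j => by simp only [hfp, hgP])
      (fun i => h * (k i : ℕ))]
    congr 1
    funext x
    rw [hgv, abs_mul]
    rfl
  have hint : ∀ k : Fin 3 → Fin κ,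
      IntegrableOn (fun x => |f (fun i => x i + h * (k i : ℕ))| * |g x|) Q := by
    intro k
    refine IntegrableOn.continuousOn_mul ?_ hgi.abs isCompact_Icc
    have hfcont := hc.continuous
    exact (by fun_prop : Continuous fun x : Fin 3 → ℝ =>
      |f (fun i => x i + h * (k i : ℕ))|).continuousOn
  have hsum : (κ : ℝ) ^ 3 * ∫ x in Q, |f x * g x| =
      ∫ x in Q, (∑ k : Fin 3 → Fin κ, |f (fun i => x i + h * (k i : ℕ))|) * |g x| := by
    simp only [Finset.sum_mul]
    rw [integral_finsetSum _ (fun k _ => hint k)]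
    simp [htr]
  have hle : (κ : ℝ) ^ 3 * ∫ x in Q, |f x * g x| ≤
      (κ : ℝ) ^ 3 * C_f * ∫ x in Q, |g x| := by
    rw [hsum, ← integral_const_mul]
    apply integral_mono
    · simp only [Finset.sum_mul]
      exact integrable_finsetSum _ fun k _ => hint k
    · exact hgi.abs.const_mul _
    · intro x
      exact mul_le_mul_of_nonneg_right (hF x) (abs_nonneg _)
  rw [mul_assoc] at hle
  rw [one_mul]
  exact le_of_mul_le_mul_left hle (by positivity)
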